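/- Let $k$ be a field of characteristic zero, $t \geq 2$, $\beta \in k^\times$, and let $A$ be the $2t \times 2t$ block matrix with $t$ blocks of size $2$: diagonal blocks equal to $B = \begin{pmatrix}0&0\\1&0\end{pmatrix}$ except the last diagonal block which is $\alpha_{t-1}I_2 + B$, subdiagonal blocks equal to $I_2$, last block column entries $\alpha_i I_2$ for $0 \leq i \leq t-2$, and zeros elsewhere, where $\alpha_i = (-1)^{t+1-i}\binom{t}{i}\beta^{t-i}$. Then $A$ is invertible, its only eigenvalue is $\beta$, and its Jordan form is $J_{t-1}(\beta) \oplus J_{t+1}(\beta)$. -/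

import Mathlib

open Polynomial

/-- The `2t × 2t` block matrix (with `2 × 2` blocks indexed by `0, …, t-1`):
diagonal blocks `B = !![0,0;1,0]` except the last one which is `α_{t-1} I₂ + B`,
subdiagonal blocks `I₂`, last block column entries `α_i I₂` for `0 ≤ i ≤ t-2`,
zeros elsewhere, where `α_i = (-1)^(t+1-i) (t choose i) β^(t-i)`.
Row `p` lies in block row `p / 2` with inner index `p % 2`. -/
def bigMat {k : Type*} [CommRing k] (t : ℕ) (β : k) : Matrix (Fin (2 * t)) (Fin (2 * t)) k :=
  Matrix.of fun p q =>
    let i := (p : ℕ) / 2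
    let j := (q : ℕ) / 2
    let a := (p : ℕ) % 2
    let b := (q : ℕ) % 2
    let α : ℕ → k := fun i => (-1) ^ (t + 1 - i) * (t.choose i) * β ^ (t - i)
    let Bm : k := if a = 1 ∧ b = 0 then 1 else 0
    let I2 : k := if a = b then 1 else 0
    if i = j then (if i = t - 1 then α (t - 1) * I2 + Bm else Bm)
    else if i = j + 1 then I2
    else if j = t - 1 then α i * I2
    else 0

/-- The direct sum `J_{t-1}(β) ⊕ J_{t+1}(β)` as a `2t × 2t` matrix: diagonal `β`,
subdiagonal `1` except at the junction row `t - 1`. -/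
def jordanSum {k : Type*} [CommRing k] (t : ℕ) (β : k) : Matrix (Fin (2 * t)) (Fin (2 * t)) k :=
  Matrix.of fun p q =>
    if p = q then β else if (p : ℕ) = (q : ℕ) + 1 ∧ (p : ℕ) ≠ t - 1 then 1 else 0

/-- coordinates of `f + g e` in `k[z]/(z-β)^t ⊗ k[e]/e^2` -/
noncomputable def phi {k : Type*} [Field k] (t : ℕ) (β : k) (f g : k[X]) : Fin (2 * t) → k :=
  fun p => (modByMonicHom ((X - C β) ^ t) (if (p : ℕ) % 2 = 0 then f else g)).coeff ((p : ℕ) / 2)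

theorem phi_add {k : Type*} [Field k] (t : ℕ) (β : k) (f g f' g' : k[X]) :
    phi t β (f + f') (g + g') = phi t β f g + phi t β f' g' := by
  funext p
  simp only [phi, Pi.add_apply]
  split_ifs <;> simp only [map_add, coeff_add]

theorem phi_smul {k : Type*} [Field k] (t : ℕ) (β c : k) (f g : k[X]) :
    phi t β (C c * f) (C c * g) = c • phi t β f g := by
  funext p
  simp only [phi, Pi.smul_apply, ← smul_eq_C_mul]
  split_ifs <;> simp only [map_smul, coeff_smul]

theorem phi_zero {k : Type*} [Field k] (t : ℕ) (β : k) : phi t β 0 0 = 0 := by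
  funext p
  simp [phi]

theorem monic_m {k : Type*} [Field k] (t : ℕ) (β : k) : ((X - C β) ^ t).Monic :=
  (monic_X_sub_C β).pow t

theorem phi_mod {k : Type*} [Field k] (t : ℕ) (β : k) (f g f' g' : k[X]) :
    phi t β (f + (X - C β) ^ t * f') (g + (X - C β) ^ t * g') = phi t β f g := by
  funext p
  simp only [phi, modByMonicHom_apply]
  have h : ∀ a b : k[X], (a + (X - C β) ^ t * b) %ₘ ((X - C β) ^ t) = a %ₘ ((X - C β) ^ t) := by
    intro a b
    rw [add_modByMonic, (modByMonic_eq_zero_iff_dvd (monic_m t β)).2 (dvd_mul_right _ _), add_zero]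
  split_ifs <;> rw [h]

theorem bigMat_apply' {k : Type*} [Field k] (t : ℕ) (ht : 2 ≤ t) (β : k) (p q : Fin (2 * t)) :
    bigMat t β p q = (if (q : ℕ) + 2 = p then 1 else 0)
      + (if (p : ℕ) % 2 = 1 ∧ (q : ℕ) + 1 = p then 1 else 0)
      + (if (q : ℕ) = 2 * (t - 1) + (p : ℕ) % 2 then
          (-1) ^ (t + 1 - (p : ℕ) / 2) * (t.choose ((p : ℕ) / 2)) * β ^ (t - (p : ℕ) / 2) else 0) := by
  obtain ⟨p, hp⟩ := p
  obtain ⟨q, hq⟩ := q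
  simp only [bigMat, Matrix.of_apply]
  have h1 : (q + 2 = p) ↔ (p / 2 = q / 2 + 1 ∧ p % 2 = q % 2) := by omega
  have h2 : (p % 2 = 1 ∧ q + 1 = p) ↔ (p / 2 = q / 2 ∧ p % 2 = 1 ∧ q % 2 = 0) := by omega
  have h3 : (q = 2 * (t - 1) + p % 2) ↔ (q / 2 = t - 1 ∧ p % 2 = q % 2) := by omega
  have h4 : p / 2 < t := by omega
  have h5 : q / 2 < t := by omega
  simp only [h1, h2, h3]
  generalize p / 2 = i at *
  generalize q / 2 = j at *
  generalize p % 2 = a at *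
  generalize q % 2 = b at *
  clear h1 h2 h3 hp hq
  by_cases e1 : i = j
  · subst e1
    by_cases e2 : i = t - 1
    · subst e2; by_cases e3 : a = b <;> simp [e3, add_comm]
    · simp [e2]
  · by_cases e2 : i = j + 1
    · have : j ≠ t - 1 := by omega
      simp [e2, this]
    · by_cases e3 : j = t - 1
      · simp [e1, e2, e3]
        simp [e3] at e1 e2
        by_cases e4 : a = b <;> simp [e1, e2, e4]
      · simp [e1, e2, e3]

theorem mod_X_mul {k : Type*} [Field k] (t : ℕ) (β : k) (f : k[X]) (ht : 2 ≤ t) :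
    (X * f) %ₘ ((X - C β) ^ t) = X * (f %ₘ ((X - C β) ^ t))
      - C ((f %ₘ ((X - C β) ^ t)).coeff (t - 1)) * (X - C β) ^ t := by
  set m := (X - C β) ^ t with hm
  have mm : m.Monic := monic_m t β
  have md : m.natDegree = t := by simp [hm]
  have hr : (f %ₘ m).natDegree < t := by
    have := natDegree_modByMonic_lt f mm (by intro h; rw [h] at md; simp at md; omega)
    omega
  set r := f %ₘ m with hrr
  set c := r.coeff (t - 1)
  refine ((div_modByMonic_unique (X * (f /ₘ m) + C c) (X * r - C c * m) mm ⟨?_, ?_⟩).2)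
  · conv_rhs => rw [← modByMonic_add_div f m]
    rw [← hrr]; ring
  · rw [degree_eq_natDegree mm.ne_zero, md, degree_lt_iff_coeff_zero]
    intro n hn
    rw [coeff_sub, coeff_C_mul]
    obtain ⟨n, rfl⟩ : ∃ n', n = n' + 1 := ⟨n - 1, by omega⟩
    rw [coeff_X_mul]
    rcases Nat.lt_or_ge (n+1) (t+1) with h | h
    · have : n + 1 = t := by omega
      have h1 : m.coeff (n + 1) = 1 := by rw [this, ← md]; exact mm
      have h2 : n = t - 1 := by omega
      rw [h1, h2]; simp [c]
    · rw [coeff_eq_zero_of_natDegree_lt (by omega : r.natDegree < n),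
        coeff_eq_zero_of_natDegree_lt (by omega : m.natDegree < n + 1)]
      simp

theorem sum_fin_ite {k : Type*} [Field k] (n : ℕ) (a : ℕ) (v : Fin n → k) (c : k) :
    ∑ q : Fin n, (if (q : ℕ) = a then c else 0) * v q
      = if h : a < n then c * v ⟨a, h⟩ else 0 := by
  split_ifs with h
  · rw [Finset.sum_eq_single ⟨a, h⟩]
    · simp
    · intro b _ hb
      have : (b : ℕ) ≠ a := fun e => hb (Fin.ext e)
      simp [this]
    · simp
  · apply Finset.sum_eq_zero
    intro b _
    have : (b : ℕ) ≠ a := by have := b.2; omega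
    simp [this]

theorem bigMat_phi {k : Type*} [Field k] (t : ℕ) (ht : 2 ≤ t) (β : k) (f g : k[X]) :
    (bigMat t β).mulVec (phi t β f g) = phi t β (X * f) (X * g + f) := by
  funext p
  have hp := p.2
  simp only [Matrix.mulVec, dotProduct, bigMat_apply' t ht, add_mul, Finset.sum_add_distrib]
  have key : ∀ h : k[X], ((X * h) %ₘ ((X - C β) ^ t)).coeff ((p : ℕ) / 2)
      = (if 2 ≤ (p : ℕ) then (h %ₘ ((X - C β) ^ t)).coeff (((p : ℕ) - 2) / 2) else 0)
       + (-1) ^ (t + 1 - (p : ℕ) / 2) * (t.choose ((p : ℕ) / 2)) * β ^ (t - (p : ℕ) / 2) *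
         (h %ₘ ((X - C β) ^ t)).coeff (t - 1) := by
    intro h
    rw [mod_X_mul t β h ht, coeff_sub, coeff_C_mul]
    have e0 : ((X - C β) ^ t).coeff ((p : ℕ) / 2)
        = (-β) ^ (t - (p : ℕ) / 2) * (t.choose ((p : ℕ) / 2) : k) := by
      rw [sub_eq_add_neg, ← C_neg, coeff_X_add_C_pow]
    rw [e0]
    have e1 : t + 1 - (p : ℕ) / 2 = (t - (p : ℕ) / 2) + 1 := by omega
    have e2 : (X * (h %ₘ ((X - C β) ^ t))).coeff ((p : ℕ) / 2) =
      (if 2 ≤ (p : ℕ) then (h %ₘ ((X - C β) ^ t)).coeff (((p : ℕ) - 2) / 2) else 0) := by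
      split_ifs with h2
      · have : (p : ℕ) / 2 = ((p : ℕ) - 2) / 2 + 1 := by omega
        rw [this, coeff_X_mul]
      · have : (p : ℕ) / 2 = 0 := by omega
        rw [this]; simp
    rw [e1, e2, neg_pow β]
    ring
  have s1 : ∀ v : Fin (2 * t) → k, ∑ q : Fin (2 * t), (if (q : ℕ) + 2 = p then (1 : k) else 0) * v q
      = if h : 2 ≤ (p : ℕ) then v ⟨(p : ℕ) - 2, by omega⟩ else 0 := by
    intro v
    split_ifs with h
    · have : ∀ q : Fin (2 * t), ((q : ℕ) + 2 = p) ↔ ((q : ℕ) = (p : ℕ) - 2) := by intro q; omega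
      simp only [this, sum_fin_ite]
      rw [dif_pos (by omega)]; simp
    · apply Finset.sum_eq_zero
      intro q _
      rw [if_neg (by omega)]; simp
  have s2 : ∀ v : Fin (2 * t) → k,
      ∑ q : Fin (2 * t), (if (p : ℕ) % 2 = 1 ∧ (q : ℕ) + 1 = p then (1 : k) else 0) * v q
      = if h : (p : ℕ) % 2 = 1 then v ⟨(p : ℕ) - 1, by omega⟩ else 0 := by
    intro v
    split_ifs with h
    · have : ∀ q : Fin (2 * t), ((p : ℕ) % 2 = 1 ∧ (q : ℕ) + 1 = p) ↔ ((q : ℕ) = (p : ℕ) - 1) := by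
        intro q; omega
      simp only [this, sum_fin_ite]
      rw [dif_pos (by omega)]; simp
    · apply Finset.sum_eq_zero
      intro q _
      rw [if_neg (by omega)]; simp
  have s3 : ∀ (v : Fin (2 * t) → k) (c : k),
      ∑ q : Fin (2 * t), (if (q : ℕ) = 2 * (t - 1) + (p : ℕ) % 2 then c else 0) * v q
      = c * v ⟨2 * (t - 1) + (p : ℕ) % 2, by omega⟩ := by
    intro v c
    rw [sum_fin_ite, dif_pos (by omega)]
  rw [s1, s2, s3]
  have m2 : (2 * (t - 1) + (p : ℕ) % 2) % 2 = (p : ℕ) % 2 := by omega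
  have m3 : (2 * (t - 1) + (p : ℕ) % 2) / 2 = t - 1 := by omega
  have m1 : 2 ≤ (p : ℕ) → ((p : ℕ) - 2) % 2 = (p : ℕ) % 2 := by omega
  simp only [phi, modByMonicHom_apply, m2, m3]
  by_cases hpar : (p : ℕ) % 2 = 0
  · rw [if_pos hpar, if_pos hpar, key, dif_neg (by omega : ¬ (p : ℕ) % 2 = 1), add_zero]
    congr 1
    by_cases h2 : 2 ≤ (p : ℕ)
    · rw [dif_pos h2, if_pos h2, m1 h2, if_pos hpar]
    · rw [dif_neg h2, if_neg h2]
  · have h1 : (p : ℕ) % 2 = 1 := by omega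
    have m4 : ((p : ℕ) - 1) % 2 = 0 := by omega
    have m5 : ((p : ℕ) - 1) / 2 = (p : ℕ) / 2 := by omega
    rw [if_neg hpar, if_neg hpar, add_modByMonic, coeff_add, key, dif_pos h1, m4, m5, if_pos rfl]
    rw [add_right_comm]
    congr 2
    by_cases h2 : 2 ≤ (p : ℕ)
    · rw [dif_pos h2, if_pos h2, m1 h2, if_neg hpar]
    · rw [dif_neg h2, if_neg h2]

theorem phi_surj {k : Type*} [Field k] (t : ℕ) (ht : 2 ≤ t) (β : k) (v : Fin (2 * t) → k) :
    ∃ f g, phi t β f g = v := by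
  have h : ∀ w : Fin t → k, ∃ f : k[X], ∀ i : Fin t, (f %ₘ ((X - C β) ^ t)).coeff i = w i := by
    intro w
    refine ⟨∑ i : Fin t, monomial (i : ℕ) (w i), fun i => ?_⟩
    have md : ((X - C β) ^ t : k[X]).degree = t := by simp
    rw [(modByMonic_eq_self_iff (monic_m t β)).2, finsetSum_coeff]
    · simp only [coeff_monomial]
      rw [Finset.sum_eq_single i]
      · simp
      · intro b _ hb
        rw [if_neg (fun e => hb (Fin.ext e))]
      · simp
    · rw [md]
      rw [degree_lt_iff_coeff_zero]
      intro n hn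
      rw [finsetSum_coeff]
      apply Finset.sum_eq_zero
      intro b _
      rw [coeff_monomial, if_neg (by omega)]
  obtain ⟨f, hf⟩ := h fun i => v ⟨2 * i, by omega⟩
  obtain ⟨g, hg⟩ := h fun i => v ⟨2 * i + 1, by omega⟩
  refine ⟨f, g, ?_⟩
  funext p
  have hp := p.2
  simp only [phi, modByMonicHom_apply]
  split_ifs with h
  · have := hf ⟨(p : ℕ) / 2, by omega⟩
    simp only at this
    rw [this]; congr 1; apply Fin.ext; simp only; omega
  · have := hg ⟨(p : ℕ) / 2, by omega⟩
    simp only at this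
    rw [this]; congr 1; apply Fin.ext; simp only; omega

/-- columns of the transition matrix -/
noncomputable def col {k : Type*} [Field k] (t : ℕ) (β : k) (q : ℕ) : Fin (2 * t) → k :=
  if q + 1 < t then phi t β ((X - C β) ^ (q + 1)) (C ((q : k) + 1 - t) * (X - C β) ^ q)
  else phi t β ((X - C β) ^ (q + 1 - t)) (C ((q + 1 - t : ℕ) : k) * (X - C β) ^ (q + 1 - t - 1))

theorem bigMat_col {k : Type*} [Field k] (t : ℕ) (ht : 2 ≤ t) (β : k) (q : ℕ) (hq : q < 2 * t) :
    (bigMat t β).mulVec (col t β q) =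
      β • col t β q + (if q + 1 < 2 * t ∧ q + 1 ≠ t - 1 then col t β (q + 1) else 0) := by
  have hA : ∀ f g : k[X], (bigMat t β).mulVec (phi t β f g)
      = β • phi t β f g + phi t β ((X - C β) * f) ((X - C β) * g + f) := by
    intro f g
    rw [bigMat_phi t ht, ← phi_smul, ← phi_add]
    congr 1 <;> ring
  by_cases h1 : q + 1 < t
  · simp only [col, if_pos h1, hA]
    congr 1
    by_cases h2 : q + 1 = t - 1
    · have : t = q + 2 := by omega
      subst this
      rw [if_neg (by omega)]
      rw [← phi_zero (q + 2) β, ← phi_mod (q + 2) β 0 0 1 0]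
      congr 1
      · ring
      · push_cast
        simp only [map_sub, map_add, map_natCast, map_one, map_ofNat]
        ring
    · rw [if_pos (by omega), if_pos (by omega)]
      congr 1
      · ring
      · push_cast
        simp only [map_sub, map_add, map_natCast, map_one]
        ring
  · simp only [col, if_neg h1, hA]
    congr 1
    obtain ⟨d, hd⟩ : ∃ d, q + 1 = t + d := ⟨q + 1 - t, by omega⟩
    have e1 : q + 1 - t = d := by omega
    have e2 : q + 1 + 1 - t = d + 1 := by omega
    have e3 : ¬ (q + 1 + 1 < t) := by omega
    rw [e1, e2, if_neg e3]
    have e4 : (X - C β) * (C (d : k) * (X - C β) ^ (d - 1)) = C (d : k) * (X - C β) ^ d := by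
      rcases d with _ | d
      · simp
      · rw [Nat.add_sub_cancel]; ring
    rw [e4]
    by_cases h2 : q + 1 < 2 * t
    · rw [if_pos (by omega), Nat.add_sub_cancel]
      congr 1
      · ring
      · push_cast
        simp only [map_add, map_natCast, map_one]
        ring
    · have : d = t := by omega
      subst this
      rw [if_neg (by omega)]
      rw [← phi_zero d β, ← phi_mod d β 0 0 (X - C β) (C (d : k) + 1)]
      congr 1 <;> ring

theorem span_all {k : Type*} [Field k] [CharZero k] (t : ℕ) (ht : 2 ≤ t) (β : k)
    (S : Submodule k (Fin (2 * t) → k)) (hS : ∀ q, q < 2 * t → col t β q ∈ S) : S = ⊤ := by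
  have ht0 : (t : k) ≠ 0 := by exact_mod_cast (by omega : t ≠ 0)
  have hcol1 : ∀ d, d + 1 < t →
      phi t β ((X - C β) ^ (d + 1)) (C ((d : k) + 1 - t) * (X - C β) ^ d) ∈ S := by
    intro d hd
    have := hS d (by omega)
    rwa [col, if_pos hd] at this
  have hcol2 : ∀ d, d < t →
      phi t β ((X - C β) ^ (d + 1)) (C ((d : k) + 1) * (X - C β) ^ d) ∈ S := by
    intro d hd
    have := hS (t + d) (by omega)
    rw [col, if_neg (by omega), show t + d + 1 - t = d + 1 by omega] at this
    simpa using this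
  have hcol0 : phi t β 1 0 ∈ S := by
    have := hS (t - 1) (by omega)
    rw [col, if_neg (by omega), show t - 1 + 1 - t = 0 by omega] at this
    simpa using this
  have hg : ∀ d, phi t β 0 ((X - C β) ^ d) ∈ S := by
    intro d
    rcases Nat.lt_trichotomy (d + 1) t with h | h | h
    · have h3 := S.smul_mem (t : k)⁻¹ (S.sub_mem (hcol2 d (by omega)) (hcol1 d h))
      convert h3 using 1
      have : phi t β ((X - C β) ^ (d + 1)) (C ((d : k) + 1) * (X - C β) ^ d)
         = phi t β ((X - C β) ^ (d + 1)) (C ((d : k) + 1 - t) * (X - C β) ^ d)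
          + (t : k) • phi t β 0 ((X - C β) ^ d) := by
        rw [← phi_smul, ← phi_add]
        congr 1
        · ring
        · simp only [map_sub, map_add, map_natCast, map_one]; ring
      rw [this, add_sub_cancel_left, smul_smul, inv_mul_cancel₀ ht0, one_smul]
    · have h3 := S.smul_mem (t : k)⁻¹ (hcol2 d (by omega))
      convert h3 using 1
      have : phi t β ((X - C β) ^ (d + 1)) (C ((d : k) + 1) * (X - C β) ^ d)
         = (t : k) • phi t β 0 ((X - C β) ^ d) := by
        rw [← phi_smul, ← phi_mod t β (C (t : k) * 0) _ 1 0]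
        congr 1
        · rw [h]; ring
        · rw [← h]; simp
      rw [this, smul_smul, inv_mul_cancel₀ ht0, one_smul]
    · obtain ⟨e, rfl⟩ : ∃ e, d = t + e := ⟨d - t, by omega⟩
      have : phi t β 0 ((X - C β) ^ (t + e)) = 0 := by
        rw [← phi_zero t β, ← phi_mod t β 0 0 0 ((X - C β) ^ e)]
        congr 1 <;> ring
      rw [this]; exact S.zero_mem
  have hf : ∀ d, phi t β ((X - C β) ^ d) 0 ∈ S := by
    intro d
    rcases d with _ | d
    · simpa using hcol0
    rcases Nat.lt_or_ge d t with h | h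
    · have h3 := S.sub_mem (hcol2 d h) (S.smul_mem ((d : k) + 1) (hg d))
      convert h3 using 1
      rw [eq_sub_iff_add_eq, ← phi_smul, ← phi_add]
      congr 1 <;> ring
    · obtain ⟨e, rfl⟩ : ∃ e, d = t + e := ⟨d - t, by omega⟩
      have : phi t β ((X - C β) ^ (t + e + 1)) 0 = 0 := by
        rw [← phi_zero t β, ← phi_mod t β 0 0 ((X - C β) ^ (e + 1)) 0]
        congr 1 <;> ring
      rw [this]; exact S.zero_mem
  have hfa : ∀ h : k[X], phi t β (h.comp (X - C β)) 0 ∈ S := by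
    intro h
    induction h using Polynomial.induction_on' with
    | add a b ha hb =>
      have := S.add_mem ha hb
      rw [← phi_add] at this
      simpa using this
    | monomial n a =>
      have := S.smul_mem a (hf n)
      rw [← phi_smul] at this
      simpa using this
  have hga : ∀ h : k[X], phi t β 0 (h.comp (X - C β)) ∈ S := by
    intro h
    induction h using Polynomial.induction_on' with
    | add a b ha hb =>
      have := S.add_mem ha hb
      rw [← phi_add] at this
      simpa using this
    | monomial n a =>
      have := S.smul_mem a (hg n)
      rw [← phi_smul] at this
      simpa using this
  have hc : ∀ f : k[X], (f.comp (X + C β)).comp (X - C β) = f := by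
    intro f; rw [comp_assoc]; simp
  rw [eq_top_iff]
  intro v _
  obtain ⟨f, g, rfl⟩ := phi_surj t ht β v
  have := S.add_mem (hfa (f.comp (X + C β))) (hga (g.comp (X + C β)))
  rw [hc, hc, ← phi_add] at this
  simpa using this

/-- For `t ≥ 2` and `β ≠ 0` over a field of characteristic zero, the matrix `A` above
is invertible, its only eigenvalue is `β` (its characteristic polynomial is
`(y - β)^(2t)`), and its Jordan form is `J_{t-1}(β) ⊕ J_{t+1}(β)`. -/
theorem stmt12 {k : Type*} [Field k] [CharZero k] (t : ℕ) (ht : 2 ≤ t) (β : k) (hβ : β ≠ 0) :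
    IsUnit (bigMat t β) ∧
    (bigMat t β).charpoly = (X - C β) ^ (2 * t) ∧
    ∃ P : Matrix (Fin (2 * t)) (Fin (2 * t)) k, IsUnit P.det ∧
      bigMat t β = P * jordanSum t β * P⁻¹ := by
  classical
  set J := jordanSum t β with hJ
  set P : Matrix (Fin (2 * t)) (Fin (2 * t)) k := Matrix.of fun r q => col t β q r with hP
  have hPd : IsUnit P.det := by
    rw [← Matrix.isUnit_iff_isUnit_det, ← Matrix.mulVec_surjective_iff_isUnit]
    have := span_all t ht β (LinearMap.range P.mulVecLin) (by
      intro q hq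
      refine ⟨Pi.single ⟨q, hq⟩ 1, ?_⟩
      rw [Matrix.mulVecLin_apply, Matrix.mulVec_single_one]
      rfl)
    exact LinearMap.range_eq_top.1 this
  have hcomm : bigMat t β * P = P * J := by
    ext r q
    have h1 : (bigMat t β * P) r q = ((bigMat t β).mulVec (col t β q)) r := rfl
    rw [h1, bigMat_col t ht β q q.2, Matrix.mul_apply]
    have h2 : ∀ s : Fin (2 * t), P r s * J s q = (if (s : ℕ) = q then β else 0) * P r s
        + (if (s : ℕ) = q + 1 then (if (q : ℕ) + 1 ≠ t - 1 then 1 else 0) else 0) * P r s := by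
      intro s
      rw [← add_mul, mul_comm]
      congr 1
      simp only [hJ, jordanSum, Matrix.of_apply, Fin.ext_iff]
      by_cases e1 : (s : ℕ) = q
      · simp [e1]
      · by_cases e2 : (s : ℕ) = q + 1
        · simp [e2]
        · simp [e1, e2]
    simp only [h2, Finset.sum_add_distrib, sum_fin_ite]
    rw [dif_pos q.2]
    simp only [Pi.add_apply, Pi.smul_apply, smul_eq_mul]
    congr 1
    by_cases e1 : (q : ℕ) + 1 < 2 * t <;> by_cases e2 : (q : ℕ) + 1 = t - 1 <;> simp [e1, e2, hP]
    all_goals omega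
  have hsim : bigMat t β = P * J * P⁻¹ := by
    rw [← hcomm, Matrix.mul_assoc, Matrix.mul_nonsing_inv _ hPd, Matrix.mul_one]
  have htri : J.transpose.BlockTriangular id := by
    intro i j hij
    simp only [id] at hij
    simp only [hJ, jordanSum, Matrix.transpose_apply, Matrix.of_apply]
    rw [if_neg (ne_of_lt hij), if_neg]
    have : (j : ℕ) < i := hij
    omega
  have hchar : (bigMat t β).charpoly = (X - C β) ^ (2 * t) := by
    have hu := (Matrix.isUnit_iff_isUnit_det P).2 hPd
    obtain ⟨U, hU⟩ := hu
    have : (bigMat t β).charpoly = J.charpoly := by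
      rw [hsim, ← hU, Matrix.charpoly_units_conj]
    rw [this, ← Matrix.charpoly_transpose, Matrix.charpoly_of_upperTriangular _ htri]
    simp [hJ, jordanSum]
  refine ⟨?_, hchar, P, hPd, hsim⟩
  rw [Matrix.isUnit_iff_isUnit_det, Matrix.det_eq_sign_charpoly_coeff, hchar,
    coeff_zero_eq_eval_zero]
  simp [hβ]
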